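/- Let n ≥ 3 and let p_1, …, p_{n−1} be integers, each at least 2. If p_2 is even, then the quotient of Γ(p_1, …, p_{n−1}) by the normal closure of {x_2, x_3, …, x_{n−1}} is isomorphic to the dihedral group of order 2p_1 (the group with presentation ⟨x_0, x_1 ∣ x_0² = x_1² = (x_0x_1)^{p_1} = 1⟩). Dually, if p_{n−2} is even, then the quotient of Γ(p_1, …, p_{n−1}) by the normal closure of {x_0, x_1, …, x_{n−3}} is isomorphic to the dihedral group of order 2p_{n−1}. -/

import Mathlib

/-- The defining relations of the group `Γ(p_1, …, p_{n-1})`: the generators `x_0, …, x_{n-1}`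
are involutions, `(x_{i-1} x_i)^{p_i} = 1`, `(x_i x_j)^2 = 1` for `|i - j| ≥ 2`, together with
the extra relators `r_i` (depending on the parities of `p_i` and `p_{i+1}`). -/
def gammaRels (n : ℕ) (p : ℕ → ℕ) : Set (FreeGroup (Fin n)) :=
  {w | (∃ i : Fin n, w = (FreeGroup.of i) ^ 2)
     ∨ (∃ i j : Fin n, (i : ℕ) + 1 = (j : ℕ) ∧
          w = (FreeGroup.of i * FreeGroup.of j) ^ (p (j : ℕ)))
     ∨ (∃ i j : Fin n, (i : ℕ) + 2 ≤ (j : ℕ) ∧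
          w = (FreeGroup.of i * FreeGroup.of j) ^ 2)
     ∨ (∃ a b c : Fin n, (a : ℕ) + 1 = (b : ℕ) ∧ (b : ℕ) + 1 = (c : ℕ) ∧
         ((Even (p (b : ℕ)) ∧ Even (p (c : ℕ)) ∧
             w = (FreeGroup.of a * FreeGroup.of b * FreeGroup.of c * FreeGroup.of b) ^ 2)
        ∨ (Odd (p (b : ℕ)) ∧ Even (p (c : ℕ)) ∧
             w = (FreeGroup.of a * FreeGroup.of b * FreeGroup.of c * FreeGroup.of b *
                  FreeGroup.of c) ^ 2)
        ∨ (Even (p (b : ℕ)) ∧ Odd (p (c : ℕ)) ∧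
             w = (FreeGroup.of c * FreeGroup.of b * FreeGroup.of a * FreeGroup.of b *
                  FreeGroup.of a) ^ 2)))}

/-- The group `Γ(p_1, …, p_{n-1})`. -/
abbrev Gamma (n : ℕ) (p : ℕ → ℕ) : Type := PresentedGroup (gammaRels n p)

/-- The generator `x_i` of `Γ(p_1, …, p_{n-1})`. -/
def xg (n : ℕ) (p : ℕ → ℕ) (i : Fin n) : Gamma n p := PresentedGroup.of i

namespace DihedralGroup

variable {m : ℕ} {G : Type*} [Group G]

/-- The homomorphism `ZMod m → G`, written additively, sending `1` to an element `t` with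
`t ^ m = 1`. -/
def zmodPowersHom (t : G) (ht : t ^ m = 1) : ZMod m →+ Additive G :=
  ZMod.lift m ⟨zmultiplesHom (Additive G) (Additive.ofMul t), by
    rw [zmultiplesHom_apply, natCast_zsmul, ← ofMul_pow, ht, ofMul_one]⟩

theorem toMul_zmodPowersHom_intCast (t : G) (ht : t ^ m = 1) (k : ℤ) :
    (zmodPowersHom t ht (k : ZMod m)).toMul = t ^ k := by
  rw [zmodPowersHom, ZMod.lift_coe]
  rfl

theorem toMul_zmodPowersHom_one (t : G) (ht : t ^ m = 1) :
    (zmodPowersHom t ht 1).toMul = t := by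
  simpa using toMul_zmodPowersHom_intCast t ht 1

theorem toMul_zmodPowersHom_mul_comm {a b : G} (ha : a ^ 2 = 1) (hb : b ^ 2 = 1)
    (hab : (a * b) ^ m = 1) (k : ZMod m) :
    (zmodPowersHom (a * b) hab k).toMul * a = a * (zmodPowersHom (a * b) hab (-k)).toMul := by
  obtain ⟨k, rfl⟩ := ZMod.intCast_surjective k
  have ha' : a⁻¹ = a := inv_eq_of_mul_eq_one_left (by rw [← sq, ha])
  have hb' : b⁻¹ = b := inv_eq_of_mul_eq_one_left (by rw [← sq, hb])
  have h : SemiconjBy a (a * b)⁻¹ (a * b) := by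
    rw [SemiconjBy, mul_inv_rev, ha', hb', mul_assoc]
  have hk := (h.zpow_right k).eq
  rw [inv_zpow'] at hk
  rw [← Int.cast_neg, toMul_zmodPowersHom_intCast, toMul_zmodPowersHom_intCast, hk]

/-- The homomorphism from the dihedral group sending the reflections `sr 0` and `sr 1` to two
involutions whose product has order dividing `m`. -/
def lift (a b : G) (ha : a ^ 2 = 1) (hb : b ^ 2 = 1) (hab : (a * b) ^ m = 1) :
    DihedralGroup m →* G :=
  MonoidHom.mk'
    (fun
      | r k => (zmodPowersHom (a * b) hab k).toMul
      | sr k => a * (zmodPowersHom (a * b) hab k).toMul)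
    (by
      have hcomm := toMul_zmodPowersHom_mul_comm ha hb hab
      rintro (i | i) (j | j)
      · simp
      · simp only [r_mul_sr]
        rw [← mul_assoc, hcomm, mul_assoc, ← toMul_add, ← map_add, neg_add_eq_sub]
      · simp [mul_assoc]
      · simp only [sr_mul_sr]
        rw [mul_assoc, ← mul_assoc _ a, hcomm, mul_assoc, ← mul_assoc a a, ← sq, ha, one_mul,
          ← toMul_add, ← map_add, neg_add_eq_sub])

section lift

variable {a b : G} (ha : a ^ 2 = 1) (hb : b ^ 2 = 1) (hab : (a * b) ^ m = 1)

@[simp]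
theorem lift_sr_zero : lift a b ha hb hab (sr 0) = a := by
  change a * (zmodPowersHom (a * b) hab 0).toMul = a
  simp

@[simp]
theorem lift_sr_one : lift a b ha hb hab (sr 1) = b := by
  change a * (zmodPowersHom (a * b) hab 1).toMul = b
  rw [toMul_zmodPowersHom_one, ← mul_assoc, ← sq, ha, one_mul]

end lift

theorem closure_sr_zero_sr_one :
    Subgroup.closure {(sr 0 : DihedralGroup m), sr 1} = ⊤ := by
  have h0 : (sr 0 : DihedralGroup m) ∈ Subgroup.closure {(sr 0 : DihedralGroup m), sr 1} :=
    Subgroup.subset_closure (by simp)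
  have h1 : (sr 1 : DihedralGroup m) ∈ Subgroup.closure {(sr 0 : DihedralGroup m), sr 1} :=
    Subgroup.subset_closure (by simp)
  have hr (k : ZMod m) : r k ∈ Subgroup.closure {(sr 0 : DihedralGroup m), sr 1} := by
    obtain ⟨k, rfl⟩ := ZMod.intCast_surjective k
    simpa using Subgroup.zpow_mem _ (Subgroup.mul_mem _ h0 h1) k
  refine eq_top_iff.2 fun g _ => ?_
  rcases g with k | k
  · exact hr k
  · simpa using Subgroup.mul_mem _ h0 (hr k)

theorem hom_ext {f g : DihedralGroup m →* G} (h0 : f (sr 0) = g (sr 0))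
    (h1 : f (sr 1) = g (sr 1)) : f = g :=
  MonoidHom.eq_of_eqOn_dense closure_sr_zero_sr_one <| by
    rintro _ (rfl | rfl)
    exacts [h0, h1]

end DihedralGroup

namespace Gamma

open DihedralGroup

variable {n : ℕ} {p : ℕ → ℕ} {u : ℕ}

/-- The images of the generators of `Γ(p_1, …, p_{n-1})` in a dihedral group: `x_u` and `x_{u+1}`
go to the two generating reflections, the other generators to the identity. -/
def dihedralGen (n m u : ℕ) (i : Fin n) : DihedralGroup m :=
  if (i : ℕ) = u then sr 0 else if (i : ℕ) = u + 1 then sr 1 else 1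

theorem dihedralGen_sq (n m u : ℕ) (i : Fin n) : dihedralGen n m u i ^ 2 = 1 := by
  unfold dihedralGen
  split_ifs <;> simp [sq]

theorem dihedralGen_eq_one {m : ℕ} {i : Fin n} (h : (i : ℕ) ≠ u) (h' : (i : ℕ) ≠ u + 1) :
    dihedralGen n m u i = 1 := by
  simp [dihedralGen, h, h']

theorem lift_dihedralGen_eq_one (h1 : 1 ≤ u → Even (p u)) (h2 : u + 2 < n → Even (p (u + 2))) :
    ∀ w ∈ gammaRels n p, FreeGroup.lift (dihedralGen n (p (u + 1)) u) w = 1 := by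
  have hsq := dihedralGen_sq n (p (u + 1)) u
  have hmul (i : Fin n) : dihedralGen n (p (u + 1)) u i * dihedralGen n (p (u + 1)) u i = 1 := by
    rw [← sq, hsq]
  have hone {i : Fin n} := dihedralGen_eq_one (u := u) (m := p (u + 1)) (i := i)
  have heven {k : ℕ} (hk : Even k) (i : Fin n) : dihedralGen n (p (u + 1)) u i ^ k = 1 := by
    obtain ⟨l, rfl⟩ := hk
    rw [← two_mul, pow_mul, hsq, one_pow]
  rintro w (⟨i, rfl⟩ | ⟨i, j, hij, rfl⟩ | ⟨i, j, hij, rfl⟩ | ⟨a, b, c, hab, hbc, h⟩)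
  · simpa using hsq i
  · simp only [map_pow, map_mul, FreeGroup.lift_apply_of]
    rcases lt_trichotomy (i : ℕ) u with hi | hi | hi
    · rw [hone (i := i) (by omega) (by omega), one_mul]
      by_cases hj : (j : ℕ) = u
      · exact heven (hj ▸ h1 (by omega)) j
      · rw [hone (by omega) (by omega), one_pow]
    · have hj : (j : ℕ) = u + 1 := by omega
      simp [dihedralGen, hi, hj]
    · rw [hone (i := j) (by omega) (by omega), mul_one]
      by_cases hi' : (i : ℕ) = u + 1
      · have hj : (j : ℕ) = u + 2 := by omega
        exact heven (hj ▸ h2 (by omega)) i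
      · rw [hone (by omega) (by omega), one_pow]
  · simp only [map_pow, map_mul, FreeGroup.lift_apply_of]
    by_cases hi : (i : ℕ) = u ∨ (i : ℕ) = u + 1
    · rw [hone (i := j) (by omega) (by omega), mul_one, hsq]
    · rw [hone (i := i) (by omega) (by omega), one_mul, hsq]
  · have hcancel (i : Fin n) (y : DihedralGroup (p (u + 1))) :
        dihedralGen n (p (u + 1)) u i * (dihedralGen n (p (u + 1)) u i * y) = y := by
      rw [← mul_assoc, hmul, one_mul]
    by_cases ha : (a : ℕ) = u ∨ (a : ℕ) = u + 1
    · have hc1 := hone (i := c) (by omega) (by omega)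
      rcases h with ⟨hb, hc, rfl⟩ | ⟨hb, hc, rfl⟩ | ⟨hb, hc, rfl⟩ <;>
        simp only [map_pow, map_mul, FreeGroup.lift_apply_of]
      · simp [sq, mul_assoc, hmul, hc1]
      · simp [sq, mul_assoc, hmul, hc1]
      · rcases ha with ha | ha
        · have hcu : (c : ℕ) = u + 2 := by omega
          rw [hcu] at hc
          exact absurd (h2 (by omega)) (Nat.not_even_iff_odd.2 hc)
        · simp [hmul, hc1, hone (i := b) (by omega) (by omega)]
    · have ha1 := hone (i := a) (by omega) (by omega)
      rcases h with ⟨hb, hc, rfl⟩ | ⟨hb, hc, rfl⟩ | ⟨hb, hc, rfl⟩ <;>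
        simp only [map_pow, map_mul, FreeGroup.lift_apply_of]
      · simp [sq, mul_assoc, hmul, hcancel, ha1]
      · by_cases hbu : (b : ℕ) = u
        · rw [hbu] at hb
          exact absurd (h1 (by omega)) (Nat.not_even_iff_odd.2 hb)
        · simp [hmul, ha1, hone (i := b) hbu (by omega)]
      · simp [sq, mul_assoc, hmul, ha1]

/-- The quotient of `Γ(p_1, …, p_{n-1})` by all generators but `x_u` and `x_{u+1}` is dihedral of
order `2 p_{u+1}` as soon as the neighbouring parameters `p_u` and `p_{u+2}` are even. -/
theorem nonempty_quotient_mulEquiv_dihedralGroup (hu : u + 1 < n) (h1 : 1 ≤ u → Even (p u))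
    (h2 : u + 2 < n → Even (p (u + 2))) {S : Set (Gamma n p)}
    (hS : ∀ g, g ∈ S ↔ ∃ i : Fin n, (i : ℕ) ≠ u ∧ (i : ℕ) ≠ u + 1 ∧ g = xg n p i) :
    Nonempty ((Gamma n p ⧸ Subgroup.normalClosure S) ≃* DihedralGroup (p (u + 1))) := by
  let i₀ : Fin n := ⟨u, by omega⟩
  let i₁ : Fin n := ⟨u + 1, hu⟩
  let φ : Gamma n p →* DihedralGroup (p (u + 1)) :=
    PresentedGroup.toGroup (lift_dihedralGen_eq_one h1 h2)
  have hφ (i : Fin n) : φ (xg n p i) = dihedralGen n (p (u + 1)) u i :=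
    PresentedGroup.toGroup.of _
  have hker : Subgroup.normalClosure S ≤ φ.ker := by
    refine Subgroup.normalClosure_le_normal fun g hg => ?_
    obtain ⟨i, hi, hi', rfl⟩ := (hS g).1 hg
    exact (hφ i).trans (dihedralGen_eq_one hi hi')
  let π := QuotientGroup.mk' (Subgroup.normalClosure S)
  have hsq (i : Fin n) : xg n p i ^ 2 = 1 :=
    PresentedGroup.one_of_mem (rels := gammaRels n p) (x := FreeGroup.of i ^ 2) (.inl ⟨i, rfl⟩)
  have hpow : (xg n p i₀ * xg n p i₁) ^ p (u + 1) = 1 :=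
    PresentedGroup.one_of_mem (rels := gammaRels n p)
      (x := (FreeGroup.of i₀ * FreeGroup.of i₁) ^ p (u + 1)) (.inr (.inl ⟨i₀, i₁, rfl, rfl⟩))
  let ψ : DihedralGroup (p (u + 1)) →* Gamma n p ⧸ Subgroup.normalClosure S :=
    DihedralGroup.lift (π (xg n p i₀)) (π (xg n p i₁)) (by rw [← map_pow, hsq, map_one])
      (by rw [← map_pow, hsq, map_one]) (by rw [← map_mul, ← map_pow, hpow, map_one])
  refine ⟨MonoidHom.toMulEquiv (QuotientGroup.lift _ φ hker) ψ ?_ ?_⟩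
  · refine QuotientGroup.monoidHom_ext _ (PresentedGroup.ext fun i => ?_)
    change ψ (φ (xg n p i)) = π (xg n p i)
    rw [hφ]
    by_cases hi : (i : ℕ) = u
    · obtain rfl : i = i₀ := Fin.ext hi
      simp [dihedralGen, i₀, ψ]
    by_cases hi' : (i : ℕ) = u + 1
    · obtain rfl : i = i₁ := Fin.ext hi'
      simp [dihedralGen, i₁, ψ]
    · rw [dihedralGen_eq_one hi hi', map_one]
      exact ((QuotientGroup.eq_one_iff _).2
        (Subgroup.subset_normalClosure ((hS _).2 ⟨i, hi, hi', rfl⟩))).symm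
  · refine DihedralGroup.hom_ext ?_ ?_
    · simp only [MonoidHom.comp_apply, ψ, lift_sr_zero]
      exact (hφ i₀).trans (by simp [dihedralGen, i₀])
    · simp only [MonoidHom.comp_apply, ψ, lift_sr_one]
      exact (hφ i₁).trans (by simp [dihedralGen, i₁])

end Gamma

/-- If `p_2` is even, then the quotient of `Γ(p_1, …, p_{n-1})` by the normal closure of
`{x_2, …, x_{n-1}}` is isomorphic to the dihedral group of order `2 p_1`; dually, if `p_{n-2}`
is even, then the quotient by the normal closure of `{x_0, …, x_{n-3}}` is isomorphic to the
dihedral group of order `2 p_{n-1}`. -/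
theorem gamma_fap (n : ℕ) (hn : 3 ≤ n) (p : ℕ → ℕ)
    (hp : ∀ k : ℕ, 1 ≤ k → k ≤ n - 1 → 2 ≤ p k) :
    (Even (p 2) →
      Nonempty ((Gamma n p ⧸ Subgroup.normalClosure
        {g : Gamma n p | ∃ i : Fin n, 2 ≤ (i : ℕ) ∧ g = xg n p i}) ≃*
          DihedralGroup (p 1))) ∧
    (Even (p (n - 2)) →
      Nonempty ((Gamma n p ⧸ Subgroup.normalClosure
        {g : Gamma n p | ∃ i : Fin n, (i : ℕ) ≤ n - 3 ∧ g = xg n p i}) ≃*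
          DihedralGroup (p (n - 1)))) := by
  refine ⟨fun h => ?_, fun h => ?_⟩
  · refine Gamma.nonempty_quotient_mulEquiv_dihedralGroup (u := 0) (by omega) (by omega)
      (fun _ => h) fun g => exists_congr fun i => ?_
    rw [← and_assoc]
    exact and_congr_left' (by omega)
  · obtain ⟨k, rfl⟩ : ∃ k, n = k + 2 := ⟨n - 2, by omega⟩
    refine Gamma.nonempty_quotient_mulEquiv_dihedralGroup (u := k) (by omega) (fun _ => h)
      (by omega) fun g => exists_congr fun i => ?_
    rw [← and_assoc]
    exact and_congr_left' (by omega)
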